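/- Let R = K[[X,Y,U,V]]/(XY − UV), Ā = R/(y, u+v), and let N = coker(ζ*) where ζ: Ā^2 → Ā is the first map in a minimal free resolution of the residue field K over Ā and ζ* = Hom(ζ, Ā). Then Ann_{Ā}(N) = 0, dim_R N = 1, depth_R N = 0, and proj dim_R N = 3. -/

import Mathlib

open CategoryTheory

/-- `Ext_R^n(M, N)` as a module category object. -/
noncomputable abbrev extMod (R : Type) [CommRing R] (n : ℕ)
    (M N : Type) [AddCommGroup M] [Module R M] [AddCommGroup N] [Module R N] : ModuleCat R :=
  ((Ext R (ModuleCat R) n).obj (Opposite.op (ModuleCat.of R M))).obj (ModuleCat.of R N)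

/-- `M` has projective dimension `n` over the local ring `R` with residue field `k`:
`Ext^{n+1}(M, -) = 0` and `Ext^n(M, k) ≠ 0`. -/
def HasProjDim (R : Type) [CommRing R] (k : Type) [AddCommGroup k] [Module R k]
    (M : Type) [AddCommGroup M] [Module R M] (n : ℕ) : Prop :=
  (∀ (N : Type) (_ : AddCommGroup N) (_ : Module R N), Subsingleton (extMod R (n + 1) M N)) ∧
    Nontrivial (extMod R n M k)

/-- `M` has depth `n` over the local ring `R` with residue field `k`:
`Ext^i(k, M) = 0` for `i < n` and `Ext^n(k, M) ≠ 0`. -/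
def HasDepth (R : Type) [CommRing R] (k : Type) [AddCommGroup k] [Module R k]
    (M : Type) [AddCommGroup M] [Module R M] (n : ℕ) : Prop :=
  (∀ i < n, Subsingleton (extMod R i k M)) ∧ Nontrivial (extMod R n k M)

/-- `R = K[[X,Y,U,V]]/(XY - UV)`. -/
noncomputable abbrev psHypersurface (K : Type) [Field K] : Type :=
  MvPowerSeries (Fin 4) K ⧸
    Ideal.span {(MvPowerSeries.X 0 : MvPowerSeries (Fin 4) K) * MvPowerSeries.X 1 -
      MvPowerSeries.X 2 * MvPowerSeries.X 3}

/-- `Ā = R/(y, u+v)`, a 1-dimensional local ring. -/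
noncomputable abbrev Abar (K : Type) [Field K] (y uv : psHypersurface K) : Type :=
  psHypersurface K ⧸ Ideal.span {y, uv}

/-- `N = coker(ζ*) = Ā²/Ā·(x̄, ū)`, where `x̄, ū` generate the maximal ideal of `Ā`,
viewed as an `R`-module. -/
noncomputable abbrev Nmod (K : Type) [Field K] (y uv : psHypersurface K)
    (xb ub : Abar K y uv) : Type :=
  (Fin 2 → Abar K y uv) ⧸ Submodule.span (psHypersurface K) {![xb, ub]}


section homological
variable {R : Type} [CommRing R]

open Limits

lemma ext_subsingleton_of_isZero {M : ModuleCat.{0} R} (P : ProjectiveResolution M) (n : ℕ)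
    (h : IsZero (P.complex.X n)) (Y : ModuleCat.{0} R) :
    Subsingleton (((Ext R (ModuleCat R) n).obj (Opposite.op M)).obj Y) := by
  refine ModuleCat.subsingleton_of_isZero (IsZero.of_iso ?_ (P.isoExt n Y))
  rw [← HomologicalComplex.exactAt_iff_isZero_homology, HomologicalComplex.exactAt_iff]
  refine ShortComplex.exact_of_isZero_X₂ _ ?_
  rw [IsZero.iff_id_eq_zero]
  ext (x : _ ⟶ _)
  obtain rfl : x = 0 := h.eq_of_src _ _
  rfl

lemma ext_nontrivial_of_cocycle {M : ModuleCat.{0} R} (P : ProjectiveResolution M) (n : ℕ)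
    (Y : ModuleCat.{0} R)
    (g : P.complex.X (n+1) ⟶ Y) (hg : P.complex.d (n+2) (n+1) ≫ g = 0)
    (hg' : ∀ f : P.complex.X n ⟶ Y, P.complex.d (n+1) n ≫ f ≠ g) :
    Nontrivial (((Ext R (ModuleCat R) (n+1)).obj (Opposite.op M)).obj Y) := by
  rw [← not_subsingleton_iff_nontrivial]
  intro hs
  have hz := (ModuleCat.isZero_of_subsingleton _).of_iso (P.isoExt (R := R) (n+1) Y).symm
  rw [← HomologicalComplex.exactAt_iff_isZero_homology,
    HomologicalComplex.exactAt_iff' _ n (n+1) (n+2) (by simp) (by simp),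
    ShortComplex.moduleCat_exact_iff] at hz
  obtain ⟨f, hf⟩ := hz g (by
    simpa using! hg)
  exact hg' f (by simpa using! hf)

lemma ext_zero_nontrivial (M Y : ModuleCat.{0} R) (g : M ⟶ Y) (hg : g ≠ 0) :
    Nontrivial (((Ext R (ModuleCat R) 0).obj (Opposite.op M)).obj Y) := by
  rw [← not_subsingleton_iff_nontrivial]
  intro hs
  let P := ProjectiveResolution.of M
  have hz := (ModuleCat.isZero_of_subsingleton _).of_iso (P.isoExt (R := R) 0 Y).symm
  rw [← HomologicalComplex.exactAt_iff_isZero_homology,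
    HomologicalComplex.exactAt_iff' _ 0 0 1 (by simp) (by simp),
    ShortComplex.moduleCat_exact_iff] at hz
  let q : P.complex.X 0 ⟶ M := P.π.f 0
  have hq : P.complex.d 1 0 ≫ q = 0 := P.complex_d_comp_π_f_zero
  obtain ⟨f, hf⟩ := hz (q ≫ g) (by
    have : P.complex.d 1 0 ≫ (q ≫ g) = 0 := by rw [← Category.assoc, hq, zero_comp]
    simpa using! this)
  have h0 : (P.complex.linearYonedaObj R Y).d 0 0 = 0 := 
    HomologicalComplex.shape _ _ _ (by simp)
  have h1 : q ≫ g = 0 := by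
    rw [← hf]
    change ((P.complex.linearYonedaObj R Y).d 0 0) f = 0
    rw [h0]; rfl
  have : Epi q := inferInstanceAs (Epi (P.π.f 0))
  exact hg ((cancel_epi q).1 (by rw [h1, comp_zero]))

/-- terms -/
def resX (P0 P1 P2 P3 : ModuleCat.{0} R) : ℕ → ModuleCat.{0} R
  | 0 => P0
  | 1 => P1
  | 2 => P2
  | 3 => P3
  | _ => ModuleCat.of R PUnit

/-- differentials -/
def resd {P0 P1 P2 P3 : ModuleCat.{0} R} (d1 : P1 ⟶ P0) (d2 : P2 ⟶ P1) (d3 : P3 ⟶ P2) :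
    ∀ n, resX P0 P1 P2 P3 (n+1) ⟶ resX P0 P1 P2 P3 n
  | 0 => d1
  | 1 => d2
  | 2 => d3
  | (_+3) => 0

/-- complex -/
noncomputable def resC {P0 P1 P2 P3 : ModuleCat.{0} R} (d1 : P1 ⟶ P0) (d2 : P2 ⟶ P1) (d3 : P3 ⟶ P2)
    (h1 : d2 ≫ d1 = 0) (h2 : d3 ≫ d2 = 0) : ChainComplex (ModuleCat.{0} R) ℕ :=
  ChainComplex.of (resX P0 P1 P2 P3) (resd d1 d2 d3) (by
    intro n
    match n with
    | 0 => exact h1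
    | 1 => exact h2
    | (n+2) => exact zero_comp)

lemma resC_d {P0 P1 P2 P3 : ModuleCat.{0} R} (d1 : P1 ⟶ P0) (d2 : P2 ⟶ P1) (d3 : P3 ⟶ P2)
    (h1 : d2 ≫ d1 = 0) (h2 : d3 ≫ d2 = 0) (n : ℕ) :
    (resC d1 d2 d3 h1 h2).d (n+1) n = resd d1 d2 d3 n := ChainComplex.of_d _ _ _

/-- resolution -/
noncomputable def resP {P0 P1 P2 P3 M : ModuleCat.{0} R} (ε : P0 ⟶ M)
    (d1 : P1 ⟶ P0) (d2 : P2 ⟶ P1) (d3 : P3 ⟶ P2)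
    (h0 : d1 ≫ ε = 0) (h1 : d2 ≫ d1 = 0) (h2 : d3 ≫ d2 = 0)
    (e0 : (ShortComplex.mk d1 ε h0).Exact) (e1 : (ShortComplex.mk d2 d1 h1).Exact)
    (e2 : (ShortComplex.mk d3 d2 h2).Exact) (hε : Epi ε) (hd : Mono d3)
    (p0 : Projective P0) (p1 : Projective P1) (p2 : Projective P2) (p3 : Projective P3) :
    ProjectiveResolution M where
  complex := resC d1 d2 d3 h1 h2
  projective := by
    intro n
    match n with
    | 0 => exact p0
    | 1 => exact p1
    | 2 => exact p2
    | 3 => exact p3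
    | (n+4) => exact (ModuleCat.isZero_of_subsingleton (ModuleCat.of R PUnit)).projective
  π := (ChainComplex.toSingle₀Equiv _ _).symm ⟨ε, by rw [resC_d]; exact h0⟩
  quasiIso := ⟨fun n => by
    cases n
    · rw [ChainComplex.quasiIsoAt₀_iff, ShortComplex.quasiIso_iff_of_zeros']
      · refine (ShortComplex.exact_and_epi_g_iff_of_iso ?_).2 ⟨e0, hε⟩
        refine ShortComplex.isoMk (Iso.refl _) (Iso.refl _) (Iso.refl _) ?_ ?_
        · simpa using! (resC_d d1 d2 d3 h1 h2 0).symm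
        · simp
          rfl
      all_goals rfl
    · rename_i n
      rw [quasiIsoAt_iff_exactAt']
      · rw [HomologicalComplex.exactAt_iff' _ (n + 1 + 1) (n + 1) n (by simp) (by simp)]
        have key : ∀ (a : resX P0 P1 P2 P3 (n+2) ⟶ resX P0 P1 P2 P3 (n+1))
          (b : resX P0 P1 P2 P3 (n+1) ⟶ resX P0 P1 P2 P3 n) (hab),
          a = resd d1 d2 d3 (n+1) → b = resd d1 d2 d3 n → (ShortComplex.mk a b hab).Exact := by
          rintro _ _ hab rfl rfl
          match n with
          | 0 => exact e1
          | 1 => exact e2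
          | 2 => 
            have : (ShortComplex.mk (0 : ModuleCat.of R PUnit ⟶ P3) d3 zero_comp).Exact :=
              (ShortComplex.exact_iff_mono _ rfl).2 hd
            exact this
          | (n+3) => exact ShortComplex.exact_of_isZero_X₂ _ 
                      (ModuleCat.isZero_of_subsingleton (ModuleCat.of R PUnit))
        exact key _ _ _ (resC_d ..) (resC_d ..)
      · apply ChainComplex.exactAt_succ_single_obj⟩

end homological

section algebra
variable {R : Type} [CommRing R]

/-- first differential -/
def dOne (x y u w : R) : ((Fin 2 → R) × (Fin 2 → R) × R) →ₗ[R] (Fin 2 → R) where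
  toFun t := y • t.1 + w • t.2.1 + t.2.2 • ![x, u]
  map_add' a b := by
    simp only [Prod.fst_add, Prod.snd_add, smul_add, add_smul]; abel
  map_smul' r a := by
    simp only [Prod.smul_fst, Prod.smul_snd, smul_add, RingHom.id_apply, smul_eq_mul, mul_smul,
      smul_comm y r, smul_comm w r]

/-- second differential -/
def dTwo (x y u w : R) : ((Fin 2 → R) × R × R) →ₗ[R] ((Fin 2 → R) × (Fin 2 → R) × R) where
  toFun t := (w • t.1 - t.2.1 • ![x, u], - (y • t.1) - t.2.2 • ![x, u], y * t.2.1 + w * t.2.2)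
  map_add' a b := by
    refine Prod.ext ?_ (Prod.ext ?_ ?_)
    · simp only [Prod.fst_add, Prod.snd_add, smul_add, add_smul]; abel
    · simp only [Prod.fst_add, Prod.snd_add, smul_add, add_smul]; abel
    · simp only [Prod.fst_add, Prod.snd_add]; ring
  map_smul' r a := by
    refine Prod.ext ?_ (Prod.ext ?_ ?_)
    · simp only [Prod.smul_fst, Prod.smul_snd, smul_sub, RingHom.id_apply, smul_eq_mul, mul_smul,
        smul_comm w r]
    · simp only [Prod.smul_fst, Prod.smul_snd, smul_sub, smul_neg, RingHom.id_apply, smul_eq_mul,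
        mul_smul, smul_comm y r]
    · simp only [Prod.smul_fst, Prod.smul_snd, RingHom.id_apply, smul_eq_mul]; ring

/-- third differential -/
def dThree (x y u w : R) : R →ₗ[R] ((Fin 2 → R) × R × R) where
  toFun t := (t • ![x, u], w * t, - (y * t))
  map_add' a b := by
    refine Prod.ext ?_ (Prod.ext ?_ ?_)
    · simp only [Prod.fst_add, add_smul]
    · simp only [Prod.fst_add, Prod.snd_add]; ring
    · simp only [Prod.snd_add]; ring
  map_smul' r a := by
    refine Prod.ext ?_ (Prod.ext ?_ ?_)
    · simp only [Prod.smul_fst, RingHom.id_apply, smul_eq_mul, mul_smul]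
    · simp only [Prod.smul_fst, Prod.smul_snd, RingHom.id_apply, smul_eq_mul]; ring
    · simp only [Prod.smul_snd, RingHom.id_apply, smul_eq_mul]; ring

/-- The module `N` over a general ring. -/
abbrev NN (x y u w : R) : Type :=
  (Fin 2 → R ⧸ Ideal.span {y, w}) ⧸
    Submodule.span R {![(Ideal.Quotient.mk (Ideal.span {y, w}) x : R ⧸ Ideal.span {y, w}),
      (Ideal.Quotient.mk (Ideal.span {y, w}) u)]}

/-- augmentation -/
def eps (x y u w : R) : (Fin 2 → R) →ₗ[R] NN x y u w where
  toFun a := Submodule.Quotient.mk (fun i => Ideal.Quotient.mk (Ideal.span {y, w}) (a i))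
  map_add' _ _ := rfl
  map_smul' _ _ := rfl

lemma eps_surj (x y u w : R) : Function.Surjective (eps x y u w) := by
  intro n
  obtain ⟨f, rfl⟩ := Submodule.Quotient.mk_surjective _ n
  choose g hg using fun i => Ideal.Quotient.mk_surjective (f i)
  exact ⟨g, congrArg Submodule.Quotient.mk (funext hg)⟩

lemma eps_eq_zero_iff (x y u w : R) (a : Fin 2 → R) :
    eps x y u w a = 0 ↔ ∃ c, a 0 - c * x ∈ Ideal.span {y, w} ∧ a 1 - c * u ∈ Ideal.span {y, w} := by
  change Submodule.Quotient.mk _ = _ ↔ _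
  rw [Submodule.Quotient.mk_eq_zero, Submodule.mem_span_singleton]
  refine exists_congr fun c => ?_
  rw [← Ideal.Quotient.eq, ← Ideal.Quotient.eq, funext_iff, Fin.forall_fin_two]
  exact and_congr eq_comm eq_comm

lemma exact_zero (x y u w : R) (a : Fin 2 → R) (h : eps x y u w a = 0) :
    ∃ t, dOne x y u w t = a := by
  rw [eps_eq_zero_iff] at h
  obtain ⟨c, h0, h1⟩ := h
  rw [Ideal.mem_span_pair] at h0 h1
  obtain ⟨p, q, h0⟩ := h0
  obtain ⟨r, s, h1⟩ := h1
  refine ⟨(![p, r], ![q, s], c), ?_⟩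
  funext i
  fin_cases i
  · simp [dOne]; linear_combination h0
  · simp [dOne]; linear_combination h1

lemma comp_zero' (x y u w : R) (t) : eps x y u w (dOne x y u w t) = 0 := by
  rw [eps_eq_zero_iff]
  refine ⟨t.2.2, ?_, ?_⟩ <;> rw [Ideal.mem_span_pair]
  · refine ⟨t.1 0, t.2.1 0, ?_⟩
    change _ = (y * t.1 0 + w * t.2.1 0 + t.2.2 * x) - _
    ring
  · refine ⟨t.1 1, t.2.1 1, ?_⟩
    change _ = (y * t.1 1 + w * t.2.1 1 + t.2.2 * u) - _
    ring

lemma comp_one (x y u w : R) (t) : dOne x y u w (dTwo x y u w t) = 0 := by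
  funext i
  fin_cases i
  · change y * (w * t.1 0 - t.2.1 * x) + w * (- (y * t.1 0) - t.2.2 * x)
      + (y * t.2.1 + w * t.2.2) * x = 0
    ring
  · change y * (w * t.1 1 - t.2.1 * u) + w * (- (y * t.1 1) - t.2.2 * u)
      + (y * t.2.1 + w * t.2.2) * u = 0
    ring

lemma comp_two (x y u w : R) (t) : dTwo x y u w (dThree x y u w t) = 0 := by
  refine Prod.ext ?_ (Prod.ext ?_ ?_)
  · funext i
    fin_cases i <;> simp [dThree, dTwo] <;> ring
  · funext i
    fin_cases i <;> simp [dThree, dTwo] <;> ring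
  · simp [dThree, dTwo]; ring

lemma koszul {y w : R} (h1 : ∀ a, y * a = 0 → a = 0)
    (h2 : ∀ a b, y * a + w * b = 0 → ∃ q, b = y * q) {a b : R} (h : y * a + w * b = 0) :
    ∃ q, b = - (y * q) ∧ a = w * q := by
  obtain ⟨q, rfl⟩ := h2 a b h
  refine ⟨-q, by ring, ?_⟩
  rw [← sub_eq_zero]
  apply h1
  linear_combination h

lemma exact_one {x y u w : R} (h1 : ∀ a, y * a = 0 → a = 0)
    (h2 : ∀ a b, y * a + w * b = 0 → ∃ q, b = y * q)
    (h3 : ∀ c, x * c ∈ Ideal.span {y, w} → c ∈ Ideal.span {y, w})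
    (t) (ht : dOne x y u w t = 0) : ∃ s, dTwo x y u w s = t := by
  obtain ⟨a, b, c⟩ := t
  have e0 : y * a 0 + w * b 0 + c * x = 0 := congrFun ht 0
  have e1 : y * a 1 + w * b 1 + c * u = 0 := congrFun ht 1
  have hc : c ∈ Ideal.span {y, w} := by
    apply h3
    rw [Ideal.mem_span_pair]
    exact ⟨- a 0, - b 0, by linear_combination - e0⟩
  rw [Ideal.mem_span_pair] at hc
  obtain ⟨r, s, rfl⟩ := hc
  obtain ⟨p0, hb0, ha0⟩ := koszul h1 h2 (a := a 0 + r * x) (b := b 0 + s * x)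
    (by linear_combination e0)
  obtain ⟨p1, hb1, ha1⟩ := koszul h1 h2 (a := a 1 + r * u) (b := b 1 + s * u)
    (by linear_combination e1)
  refine ⟨(![p0, p1], r, s), ?_⟩
  refine Prod.ext ?_ (Prod.ext ?_ ?_)
  · funext i
    fin_cases i
    · simp [dTwo]; linear_combination - ha0
    · simp [dTwo]; linear_combination - ha1
  · funext i
    fin_cases i
    · simp [dTwo]; linear_combination - hb0
    · simp [dTwo]; linear_combination - hb1
  · simp [dTwo]; ring

lemma exact_two {x y u w : R} (h1 : ∀ a, y * a = 0 → a = 0)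
    (h2 : ∀ a b, y * a + w * b = 0 → ∃ q, b = y * q)
    (t) (ht : dTwo x y u w t = 0) : ∃ s, dThree x y u w s = t := by
  obtain ⟨p, r, s⟩ := t
  have hb := congrArg (fun z => z.2.1) ht
  have hc := congrArg (fun z => z.2.2) ht
  have e0 : - (y * p 0) - s * x = 0 := congrFun hb 0
  have e1 : - (y * p 1) - s * u = 0 := congrFun hb 1
  simp [dTwo] at hc
  obtain ⟨q, hs, hr⟩ := koszul h1 h2 hc
  refine ⟨q, ?_⟩
  refine Prod.ext ?_ (Prod.ext ?_ ?_)
  · funext i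
    fin_cases i
    · simp [dThree]; rw [← sub_eq_zero]; apply h1; subst hs; linear_combination e0
    · simp [dThree]; rw [← sub_eq_zero]; apply h1; subst hs; linear_combination e1
  · simp [dThree, hr]
  · simp [dThree, hs]

lemma dThree_inj {x y u w : R} (h1 : ∀ a, y * a = 0 → a = 0) :
    Function.Injective (dThree x y u w) := by
  rw [injective_iff_map_eq_zero]
  intro a ha
  have := congrArg (fun z => z.2.2) ha
  simp [dThree] at this
  exact h1 a this

lemma NN_annihilator {x y u w : R}
    (h3 : ∀ c, x * c ∈ Ideal.span {y, w} → c ∈ Ideal.span {y, w}) :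
    Module.annihilator R (NN x y u w) = Ideal.span {y, w} := by
  ext a
  rw [Module.mem_annihilator]
  constructor
  · intro h
    have := h (eps x y u w ![0, 1])
    rw [← map_smul, eps_eq_zero_iff] at this
    obtain ⟨c, hc0, hc1⟩ := this
    simp at hc0 hc1
    have hc := h3 c (by rwa [mul_comm])
    have := add_mem hc1 (Ideal.mul_mem_right u _ hc)
    simpa using this
  · intro ha n
    obtain ⟨b, rfl⟩ := eps_surj x y u w n
    rw [← map_smul, eps_eq_zero_iff]
    exact ⟨0, by simpa using Ideal.mul_mem_right _ _ ha, by simpa using Ideal.mul_mem_right _ _ ha⟩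

lemma NN_depth {x y u v w : R} (hw : w = u + v) (huu : u * u ∈ Ideal.span {y, w})
    (h6 : ∀ a, u - a * x ∉ Ideal.span {y, w}) :
    HasDepth R (R ⧸ Ideal.span {x, y, u, v}) (NN x y u w) 0 := by
  refine ⟨by simp, ?_⟩
  let n : NN x y u w := eps x y u w ![u, 0]
  have hy : y ∈ Ideal.span {y, w} := Ideal.subset_span (by simp)
  have hww : w ∈ Ideal.span {y, w} := Ideal.subset_span (by simp)
  have hn : Ideal.span {x, y, u, v} ≤ LinearMap.ker (LinearMap.toSpanSingleton R _ n) := by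
    rw [Ideal.span_le]
    have hu : u ∈ LinearMap.ker (LinearMap.toSpanSingleton R _ n) := by
      rw [LinearMap.mem_ker, LinearMap.toSpanSingleton_apply, ← map_smul, eps_eq_zero_iff]
      exact ⟨0, by simpa using huu, by simp⟩
    have hv : w ∈ LinearMap.ker (LinearMap.toSpanSingleton R _ n) := by
      rw [LinearMap.mem_ker, LinearMap.toSpanSingleton_apply, ← map_smul, eps_eq_zero_iff]
      exact ⟨0, by simpa using Ideal.mul_mem_right _ _ hww, by simp⟩
    rintro z (rfl | rfl | rfl | rfl)
    · rw [SetLike.mem_coe, LinearMap.mem_ker, LinearMap.toSpanSingleton_apply, ← map_smul,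
        eps_eq_zero_iff]
      exact ⟨u, by simp [mul_comm], by simpa using huu⟩
    · rw [SetLike.mem_coe, LinearMap.mem_ker, LinearMap.toSpanSingleton_apply, ← map_smul,
        eps_eq_zero_iff]
      exact ⟨0, by simpa using Ideal.mul_mem_right _ _ hy, by simp⟩
    · exact hu
    · have h := sub_mem hv hu
      have hz : z = w - u := by rw [hw]; ring
      rw [SetLike.mem_coe, hz]
      exact h
  refine ext_zero_nontrivial _ _ (ModuleCat.ofHom (Submodule.liftQ _ _ hn)) ?_
  intro h0
  have h00 := congrArg (fun f => f.hom (Submodule.Quotient.mk 1)) h0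
  have h01 : (LinearMap.toSpanSingleton R _ n) 1 = 0 := h00
  rw [LinearMap.toSpanSingleton_apply, one_smul, eps_eq_zero_iff] at h01
  obtain ⟨c, hc, -⟩ := h01
  exact h6 c (by simpa using hc)

lemma NN_projDim {x y u v w : R} (hw : w = u + v) (h1 : ∀ a, y * a = 0 → a = 0)
    (h2 : ∀ a b, y * a + w * b = 0 → ∃ q, b = y * q)
    (h3 : ∀ c, x * c ∈ Ideal.span {y, w} → c ∈ Ideal.span {y, w})
    (h4 : (1 : R) ∉ Ideal.span {x, y, u, v}) :
    HasProjDim R (R ⧸ Ideal.span {x, y, u, v}) (NN x y u w) 3 := by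
  let P : ProjectiveResolution (ModuleCat.of R (NN x y u w)) :=
    resP (ModuleCat.ofHom (eps x y u w)) (ModuleCat.ofHom (dOne x y u w))
      (ModuleCat.ofHom (dTwo x y u w)) (ModuleCat.ofHom (dThree x y u w))
      (by ext1; exact LinearMap.ext (comp_zero' x y u w))
      (by ext1; exact LinearMap.ext (comp_one x y u w))
      (by ext1; exact LinearMap.ext (comp_two x y u w))
      ((ShortComplex.moduleCat_exact_iff _).2 (exact_zero x y u w))
      ((ShortComplex.moduleCat_exact_iff _).2 (exact_one h1 h2 h3))
      ((ShortComplex.moduleCat_exact_iff _).2 (exact_two h1 h2))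
      ((ModuleCat.epi_iff_surjective _).2 (eps_surj x y u w))
      ((ModuleCat.mono_iff_injective _).2 (dThree_inj h1))
      ((IsProjective.iff_projective _).1 inferInstance)
      ((IsProjective.iff_projective _).1 inferInstance)
      ((IsProjective.iff_projective _).1 inferInstance)
      ((IsProjective.iff_projective _).1 inferInstance)
  have hz : Limits.IsZero (P.complex.X 4) :=
    (ModuleCat.isZero_of_subsingleton (ModuleCat.of R PUnit))
  refine ⟨fun N _ _ => ext_subsingleton_of_isZero P 4 hz (ModuleCat.of R N), ?_⟩
  let k := R ⧸ Ideal.span {x, y, u, v}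
  let g : ModuleCat.of R R ⟶ ModuleCat.of R k := ModuleCat.ofHom (Submodule.mkQ _)
  refine ext_nontrivial_of_cocycle P 2 (ModuleCat.of R k) g (hz.eq_of_src _ _) ?_
  have hd : P.complex.d 3 2 = ModuleCat.ofHom (dThree x y u w) :=
    resC_d (ModuleCat.ofHom (dOne x y u w)) (ModuleCat.ofHom (dTwo x y u w))
      (ModuleCat.ofHom (dThree x y u w)) (by ext1; exact LinearMap.ext (comp_one x y u w))
      (by ext1; exact LinearMap.ext (comp_two x y u w)) 2
  intro f hf
  rw [hd] at hf
  let f' : ((Fin 2 → R) × R × R) →ₗ[R] k := f.hom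
  have hf1 : f' (dThree x y u w 1) = Submodule.Quotient.mk 1 :=
    congrArg (fun f => f.hom (1 : R)) hf
  have hk : ∀ z ∈ Ideal.span {x, y, u, v}, ∀ m : k, z • m = 0 := by
    intro z hz m
    obtain ⟨m, rfl⟩ := Submodule.Quotient.mk_surjective _ m
    rw [← Submodule.Quotient.mk_smul, Submodule.Quotient.mk_eq_zero]
    exact Ideal.mul_mem_right _ _ hz
  have hx : x ∈ Ideal.span {x, y, u, v} := Ideal.subset_span (by simp)
  have hy : y ∈ Ideal.span {x, y, u, v} := Ideal.subset_span (by simp)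
  have hu : u ∈ Ideal.span {x, y, u, v} := Ideal.subset_span (by simp)
  have hv : v ∈ Ideal.span {x, y, u, v} := Ideal.subset_span (by simp)
  have hww : w ∈ Ideal.span {x, y, u, v} := hw ▸ add_mem hu hv
  have hsum : dThree x y u w 1 = x • (![1, 0], 0, 0) + u • (![0, 1], 0, 0) + w • (0, 1, 0)
      + y • (0, 0, -1) := by
    refine Prod.ext ?_ (Prod.ext ?_ ?_)
    · funext i
      fin_cases i <;> simp [dThree]
    · simp [dThree]
    · simp [dThree]
  rw [hsum, map_add, map_add, map_add, map_smul, map_smul, map_smul, map_smul, hk _ hx, hk _ hu,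
    hk _ hww, hk _ hy] at hf1
  apply h4
  rw [← Submodule.Quotient.mk_eq_zero, ← hf1]
  simp

end algebra

section series
open MvPowerSeries Finsupp

variable {K : Type} [Field K]

lemma mem_of_coeff (I : Ideal (MvPowerSeries (Fin 4) K)) (s : List (Fin 4 →₀ ℕ))
    (hs : ∀ m ∈ s, monomial m (1 : K) ∈ I) (f : MvPowerSeries (Fin 4) K)
    (h : ∀ n, (∀ m ∈ s, ¬ m ≤ n) → coeff n f = 0) : f ∈ I := by
  classical
  induction s generalizing f with
  | nil =>
    have : f = 0 := by
      ext n; exact h n (by simp)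
    rw [this]; exact zero_mem _
  | cons m s ih =>
    let g : MvPowerSeries (Fin 4) K := fun n => coeff (m + n) f
    have hg : ∀ n, coeff n g = coeff (m + n) f := fun n => rfl
    have h1 : f - monomial m 1 * g ∈ I := by
      apply ih (fun m' hm' => hs m' (List.mem_cons_of_mem _ hm'))
      intro n hn
      rw [map_sub, coeff_monomial_mul]
      split_ifs with hmn
      · rw [hg, add_tsub_cancel_of_le hmn]; simp
      · rw [sub_zero]; apply h
        intro m' hm'
        rcases List.mem_cons.1 hm' with rfl | hm'
        · exact hmn
        · exact hn _ hm'
    have h2 : monomial m 1 * g ∈ I := Ideal.mul_mem_right _ _ (hs m (by simp))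
    simpa using add_mem h1 h2

lemma coeff_X_mul_of_zero (s : Fin 4) (n : Fin 4 →₀ ℕ) (hn : n s = 0)
    (f : MvPowerSeries (Fin 4) K) : coeff n (X s * f) = 0 := by
  classical
  rw [X, coeff_monomial_mul, if_neg]
  intro h
  have := h s
  simp [hn] at this

lemma coeff_X_mul_add (s : Fin 4) (n : Fin 4 →₀ ℕ)
    (f : MvPowerSeries (Fin 4) K) : coeff (n + single s 1) (X s * f) = coeff n f := by
  rw [X, add_comm, coeff_add_monomial_mul, one_mul]

lemma exists_sub (s : Fin 4) (n : Fin 4 →₀ ℕ) (h : 1 ≤ n s) : ∃ m, n = m + single s 1 :=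
  ⟨n - single s 1, (tsub_add_cancel_of_le (by simpa using h)).symm⟩

/-- `(Y, UV)` -/
lemma fact_one (f g : MvPowerSeries (Fin 4) K)
    (h : X 1 * f = g * (X 0 * X 1 - X 2 * X 3)) : ∃ g', f = g' * (X 0 * X 1 - X 2 * X 3) := by
  have hd : (X 1 : MvPowerSeries (Fin 4) K) ∣ g := by
    rw [X_dvd_iff]
    intro n hn
    have e : X 2 * (X 3 * g) = X 1 * (X 0 * g - f) := by linear_combination h
    have := congrArg (coeff (n + single 3 1 + single 2 1)) e
    rw [coeff_X_mul_add, coeff_X_mul_add, coeff_X_mul_of_zero _ _ (by simp [hn])] at this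
    exact this
  obtain ⟨g', rfl⟩ := hd
  refine ⟨g', ?_⟩
  have hX : (X 1 : MvPowerSeries (Fin 4) K) ≠ 0 := by
    intro h0
    have := congrArg (coeff (single 1 1)) h0
    rw [coeff_index_single_self_X] at this
    simp at this
  apply mul_left_cancel₀ hX
  rw [h]; ring

lemma fact_two (a b c : MvPowerSeries (Fin 4) K)
    (h : X 1 * a + (X 2 + X 3) * b = c * (X 0 * X 1 - X 2 * X 3)) :
    ∃ p q, b = X 1 * p + X 2 * X 3 * q := by
  have e : X 2 * b + X 3 * b = X 1 * (X 0 * c - a) - X 2 * (X 3 * c) := by linear_combination h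
  have e' : X 2 * b + X 3 * b = X 1 * (X 0 * c - a) - X 3 * (X 2 * c) := by linear_combination h
  have hb : b ∈ Ideal.span {X 1, (X 2 * X 3 : MvPowerSeries (Fin 4) K)} := by
    apply mem_of_coeff _ [single 1 1, single 2 1 + single 3 1]
    · intro m hm
      simp only [List.mem_cons, List.not_mem_nil, or_false] at hm
      rcases hm with rfl | rfl
      · exact Ideal.subset_span (by simp [X])
      · refine Ideal.subset_span (Or.inr ?_)
        simp [X, monomial_mul_monomial]
    · intro n hn
      have n1 : n 1 = 0 := by
        have := hn (single 1 1) (by simp)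
        simp at this; exact this
      have n23 : n 2 = 0 ∨ n 3 = 0 := by
        by_contra! hcon
        apply hn (single 2 1 + single 3 1) (by simp)
        intro i
        fin_cases i <;> simp <;> omega
      rcases n23 with n2 | n3
      · have := congrArg (coeff (n + single 3 1)) e
        rw [map_add, map_sub, coeff_X_mul_add, coeff_X_mul_of_zero 2 _ (by simp [n2]),
          coeff_X_mul_of_zero 1 _ (by simp [n1]), coeff_X_mul_of_zero 2 _ (by simp [n2])] at this
        simpa using this
      · have := congrArg (coeff (n + single 2 1)) e'
        rw [map_add, map_sub, coeff_X_mul_add, coeff_X_mul_of_zero 3 _ (by simp [n3]),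
          coeff_X_mul_of_zero 1 _ (by simp [n1]), coeff_X_mul_of_zero 3 _ (by simp [n3])] at this
        simpa using this
  rw [Ideal.mem_span_pair] at hb
  obtain ⟨p, q, hb⟩ := hb
  exact ⟨p, q, by rw [← hb]; ring⟩

lemma coeffs_J (f a b c : MvPowerSeries (Fin 4) K) (h : f = X 1 * a + (X 2 + X 3) * b + X 2 * X 3 * c)
    (n : Fin 4 →₀ ℕ) (n1 : n 1 = 0) (n2 : n 2 = 0) (n3 : n 3 = 0) :
    coeff n f = 0 ∧ coeff (n + single 2 1) f = coeff (n + single 3 1) f := by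
  have e : f = X 1 * a + X 2 * b + X 3 * b + X 2 * (X 3 * c) := by rw [h]; ring
  have e' : f = X 1 * a + X 2 * b + X 3 * b + X 3 * (X 2 * c) := by rw [h]; ring
  refine ⟨?_, ?_⟩
  · rw [e]; simp only [map_add]
    rw [coeff_X_mul_of_zero 1 _ n1, coeff_X_mul_of_zero 2 _ n2, coeff_X_mul_of_zero 2 _ n2,
      coeff_X_mul_of_zero 3 _ n3]
    simp
  · trans coeff n b
    · rw [e']; simp only [map_add]
      rw [coeff_X_mul_of_zero 1 _ (by simp [n1]), coeff_X_mul_add,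
        coeff_X_mul_of_zero 3 _ (by simp [n3]), coeff_X_mul_of_zero 3 _ (by simp [n3])]
      simp
    · rw [e]; simp only [map_add]
      rw [coeff_X_mul_of_zero 1 _ (by simp [n1]), coeff_X_mul_add,
        coeff_X_mul_of_zero 2 _ (by simp [n2]), coeff_X_mul_of_zero 2 _ (by simp [n2])]
      simp

/-- The ideal `(Y, U+V, UV)`. -/
noncomputable abbrev JJ (K : Type) [Field K] : Ideal (MvPowerSeries (Fin 4) K) :=
  Ideal.span {X 1, X 2 + X 3, X 2 * X 3}

lemma mem_JJ (f : MvPowerSeries (Fin 4) K)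
    (h : ∀ n : Fin 4 →₀ ℕ, n 1 = 0 → n 2 = 0 → n 3 = 0 →
      coeff n f = 0 ∧ coeff (n + single 2 1) f = coeff (n + single 3 1) f) : f ∈ JJ K := by
  classical
  have hY : (X 1 : MvPowerSeries (Fin 4) K) ∈ JJ K := Ideal.subset_span (by simp)
  have hW : (X 2 + X 3 : MvPowerSeries (Fin 4) K) ∈ JJ K := Ideal.subset_span (by simp)
  have hUV : (X 2 * X 3 : MvPowerSeries (Fin 4) K) ∈ JJ K := Ideal.subset_span (by simp)
  let g : MvPowerSeries (Fin 4) K := fun n =>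
    if n 1 = 0 ∧ n 2 = 0 ∧ n 3 = 0 then coeff (n + single 2 1) f else 0
  have hg : ∀ n, coeff n g =
    if n 1 = 0 ∧ n 2 = 0 ∧ n 3 = 0 then coeff (n + single 2 1) f else 0 := fun n => rfl
  have h1 : f - (X 2 * g + X 3 * g) ∈ JJ K := by
    apply mem_of_coeff _ [single 1 1, single 2 1 + single 3 1, single 2 1 + single 2 1,
      single 3 1 + single 3 1]
    · intro m hm
      simp only [List.mem_cons, List.not_mem_nil, or_false] at hm
      rcases hm with rfl | rfl | rfl | rfl
      · exact hY
      · convert hUV using 1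
        simp [X, monomial_mul_monomial]
      · have : (X 2 * X 2 : MvPowerSeries (Fin 4) K) ∈ JJ K := by
          have := sub_mem (Ideal.mul_mem_left _ (X 2) hW) hUV
          convert this using 1; ring
        convert this using 1
        simp [X, monomial_mul_monomial]
      · have : (X 3 * X 3 : MvPowerSeries (Fin 4) K) ∈ JJ K := by
          have := sub_mem (Ideal.mul_mem_left _ (X 3) hW) hUV
          convert this using 1; ring
        convert this using 1
        simp [X, monomial_mul_monomial]
    · intro n hn
      have n1 : n 1 = 0 := by
        have := hn (single 1 1) (by simp)
        simp at this; exact this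
      have n23 : n 2 = 0 ∨ n 3 = 0 := by
        by_contra! hcon
        apply hn (single 2 1 + single 3 1) (by simp)
        intro i
        fin_cases i <;> simp <;> omega
      have n22 : n 2 ≤ 1 := by
        by_contra! hcon
        apply hn (single 2 1 + single 2 1) (by simp)
        intro i
        fin_cases i <;> simp <;> omega
      have n33 : n 3 ≤ 1 := by
        by_contra! hcon
        apply hn (single 3 1 + single 3 1) (by simp)
        intro i
        fin_cases i <;> simp <;> omega
      rw [map_sub, map_add]
      by_cases n2 : n 2 = 0
      · by_cases n3 : n 3 = 0
        · rw [coeff_X_mul_of_zero 2 _ n2, coeff_X_mul_of_zero 3 _ n3, (h n n1 n2 n3).1]; simp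
        · obtain ⟨m, rfl⟩ := exists_sub 3 n (by omega)
          simp at n1 n2 n33
          rw [coeff_X_mul_add, coeff_X_mul_of_zero 2 _ (by simpa using n2), hg,
            if_pos ⟨n1, n2, n33⟩, (h m n1 n2 n33).2]
          simp
      · have n3 : n 3 = 0 := by tauto
        obtain ⟨m, rfl⟩ := exists_sub 2 n (by omega)
        simp at n1 n3 n22
        rw [coeff_X_mul_add, coeff_X_mul_of_zero 3 _ (by simpa using n3), hg,
          if_pos ⟨n1, n22, n3⟩]
        simp
  have h2 : (X 2 + X 3) * g ∈ JJ K := Ideal.mul_mem_right _ _ hW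
  have := add_mem h1 h2
  rw [add_mul] at this
  simpa using this

lemma mem_JJ' {f : MvPowerSeries (Fin 4) K} (h : f ∈ JJ K) :
    ∃ a b c, f = X 1 * a + (X 2 + X 3) * b + X 2 * X 3 * c := by
  rw [JJ, Ideal.mem_span_insert] at h
  obtain ⟨a, z, hz, rfl⟩ := h
  rw [Ideal.mem_span_pair] at hz
  obtain ⟨b, c, rfl⟩ := hz
  exact ⟨a, b, c, by ring⟩

lemma fact_three (f : MvPowerSeries (Fin 4) K) (h : X 0 * f ∈ JJ K) : f ∈ JJ K := by
  obtain ⟨a, b, c, h⟩ := mem_JJ' h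
  apply mem_JJ
  intro n n1 n2 n3
  have := coeffs_J _ a b c h (n + single 0 1) (by simp [n1]) (by simp [n2]) (by simp [n3])
  rwa [coeff_X_mul_add, add_right_comm, coeff_X_mul_add, add_right_comm n, coeff_X_mul_add] at this

lemma fact_six (f : MvPowerSeries (Fin 4) K) : X 2 - f * X 0 ∉ JJ K := by
  intro h
  obtain ⟨a, b, c, h⟩ := mem_JJ' h
  have := (coeffs_J _ a b c h 0 rfl rfl rfl).2
  rw [mul_comm f, map_sub, map_sub, coeff_X_mul_of_zero 0 _ (by simp),
    coeff_X_mul_of_zero 0 _ (by simp)] at this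
  classical
  simp [coeff_X, Finsupp.single_left_inj] at this

end series

section final
variable {K : Type} [Field K]

lemma mk_eq_zero_iff (f : MvPowerSeries (Fin 4) K) :
    (Ideal.Quotient.mk _ f : psHypersurface K) = 0 ↔
      ∃ g, f = g * (MvPowerSeries.X 0 * MvPowerSeries.X 1 -
        MvPowerSeries.X 2 * MvPowerSeries.X 3) := by
  rw [Ideal.Quotient.eq_zero_iff_mem, Ideal.mem_span_singleton']
  exact exists_congr fun _ => eq_comm

lemma mk_mem_iff (f : MvPowerSeries (Fin 4) K) :
    (Ideal.Quotient.mk _ f : psHypersurface K) ∈ Ideal.span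
      {(Ideal.Quotient.mk _ (MvPowerSeries.X 1) : psHypersurface K),
        Ideal.Quotient.mk _ (MvPowerSeries.X 2) + Ideal.Quotient.mk _ (MvPowerSeries.X 3)} ↔
      f ∈ JJ K := by
  rw [Ideal.mem_span_pair]
  constructor
  · rintro ⟨a, b, h⟩
    obtain ⟨a, rfl⟩ := Ideal.Quotient.mk_surjective a
    obtain ⟨b, rfl⟩ := Ideal.Quotient.mk_surjective b
    rw [← map_add, ← map_mul, ← map_mul, ← map_add, ← sub_eq_zero, ← map_sub,
      mk_eq_zero_iff] at h
    obtain ⟨g, hg⟩ := h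
    have e : f = (a - g * MvPowerSeries.X 0) * MvPowerSeries.X 1 +
        b * (MvPowerSeries.X 2 + MvPowerSeries.X 3) +
        g * (MvPowerSeries.X 2 * MvPowerSeries.X 3) := by linear_combination - hg
    rw [e]
    refine add_mem (add_mem ?_ ?_) ?_ <;>
    exact Ideal.mul_mem_left _ _ (Ideal.subset_span (by simp))
  · intro h
    obtain ⟨a, b, c, rfl⟩ := mem_JJ' h
    refine ⟨Ideal.Quotient.mk _ (a + c * MvPowerSeries.X 0), Ideal.Quotient.mk _ b, ?_⟩
    rw [← map_add, ← map_mul, ← map_mul, ← map_add, ← sub_eq_zero, ← map_sub,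
      mk_eq_zero_iff]
    exact ⟨c, by ring⟩

lemma dim_eq_of_nil {A B : Type} [CommRing A] [CommRing B] (χ : A →+* B)
    (hs : Function.Surjective χ) (hker : RingHom.ker χ ≤ nilradical A) :
    ringKrullDim A = ringKrullDim B := by
  have hh := PrimeSpectrum.isHomeomorph_comap χ (fun p => ⟨1, one_pos, by
    obtain ⟨q, rfl⟩ := hs p
    exact ⟨q, by simp⟩⟩) hker
  rw [← PrimeSpectrum.topologicalKrullDim_eq_ringKrullDim, ← hh.topologicalKrullDim_eq,
    PrimeSpectrum.topologicalKrullDim_eq_ringKrullDim]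

lemma exists_phi (K : Type) [Field K] : ∃ φ : MvPowerSeries (Fin 4) K →+* PowerSeries K,
    Function.Surjective φ ∧ (∀ i : Fin 4, i ≠ 0 → φ (MvPowerSeries.X i) = 0) ∧
    ∀ f, φ f = 0 → ∀ n : Fin 4 →₀ ℕ, (∀ i : Fin 4, i ≠ 0 → n i = 0) →
      MvPowerSeries.coeff n f = 0 := by
  let e : Unit ↪ Fin 4 := ⟨fun _ => 0, fun _ _ _ => rfl⟩
  refine ⟨(MvPowerSeries.killCompl (R := K) e).toRingHom, fun p =>
    ⟨MvPowerSeries.rename e p, MvPowerSeries.killCompl_rename_app p⟩, ?_, ?_⟩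
  · intro i hi
    apply MvPowerSeries.killCompl_X_eq_zero
    rintro ⟨_, h⟩
    exact hi h.symm
  · intro f hz n hn'
    have e1 : n = Finsupp.embDomain e (Finsupp.single () (n 0)) := by
      rw [Finsupp.embDomain_single]
      ext i
      by_cases hi : i = 0
      · subst hi; exact (Finsupp.single_eq_same (a := (0 : Fin 4))).symm
      · rw [hn' i hi, Finsupp.single_eq_of_ne]
        exact hi
    have := MvPowerSeries.coeff_killCompl (e := e) f (Finsupp.single () (n 0))
    rw [← e1] at this
    rw [← this]
    have hz' : MvPowerSeries.killCompl e f = 0 := hz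
    rw [hz', map_zero]

lemma dim_gen {S B : Type} [CommRing S] [CommRing B] (r : S) (y w : S ⧸ Ideal.span {r})
    (y' w' : S) (hy : y = Ideal.Quotient.mk _ y') (hw : w = Ideal.Quotient.mk _ w')
    (φ : S →+* B) (hs : Function.Surjective φ) (hr : φ r = 0) (hy' : φ y' = 0) (hw' : φ w' = 0)
    (hk : ∀ f, φ f = 0 → ∃ n : ℕ,
      (Ideal.Quotient.mk (Ideal.span {r}) (f ^ n)) ∈ Ideal.span {y, w}) :
    ringKrullDim ((S ⧸ Ideal.span {r}) ⧸ Ideal.span {y, w}) = ringKrullDim B := by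
  have hl : ∀ a ∈ Ideal.span {r}, φ a = 0 := by
    intro a ha
    rw [Ideal.mem_span_singleton'] at ha
    obtain ⟨g, rfl⟩ := ha
    rw [map_mul, hr, mul_zero]
  have hl2 : ∀ a ∈ Ideal.span {y, w}, Ideal.Quotient.lift _ φ hl a = 0 := by
    intro a ha
    rw [Ideal.mem_span_pair] at ha
    obtain ⟨g, h, rfl⟩ := ha
    rw [map_add, map_mul, map_mul, hy, hw, Ideal.Quotient.lift_mk, Ideal.Quotient.lift_mk,
      hy', hw', mul_zero, mul_zero, add_zero]
  refine dim_eq_of_nil (Ideal.Quotient.lift _ (Ideal.Quotient.lift _ φ hl) hl2) ?_ ?_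
  · intro p
    obtain ⟨f, rfl⟩ := hs p
    exact ⟨Ideal.Quotient.mk _ (Ideal.Quotient.mk _ f), rfl⟩
  · intro z hz
    obtain ⟨z, rfl⟩ := Ideal.Quotient.mk_surjective z
    obtain ⟨f, rfl⟩ := Ideal.Quotient.mk_surjective z
    rw [RingHom.mem_ker, Ideal.Quotient.lift_mk, Ideal.Quotient.lift_mk] at hz
    obtain ⟨n, hn⟩ := hk f hz
    refine mem_nilradical.2 ⟨n, ?_⟩
    rw [← map_pow, ← map_pow]
    exact Ideal.Quotient.eq_zero_iff_mem.2 hn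

lemma mem_radical_JJ (f : MvPowerSeries (Fin 4) K)
    (h : ∀ n : Fin 4 →₀ ℕ, (∀ i : Fin 4, i ≠ 0 → n i = 0) → MvPowerSeries.coeff n f = 0) :
    f ∈ (JJ K).radical := by
  have hW : (MvPowerSeries.X 2 + MvPowerSeries.X 3 : MvPowerSeries (Fin 4) K) ∈ JJ K :=
    Ideal.subset_span (by simp)
  have hUV : (MvPowerSeries.X 2 * MvPowerSeries.X 3 : MvPowerSeries (Fin 4) K) ∈ JJ K :=
    Ideal.subset_span (by simp)
  have m1 : (MvPowerSeries.X 1 : MvPowerSeries (Fin 4) K) ∈ (JJ K).radical :=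
    Ideal.le_radical (Ideal.subset_span (Or.inl rfl))
  have m2 : (MvPowerSeries.X 2 : MvPowerSeries (Fin 4) K) ∈ (JJ K).radical := by
    refine ⟨2, ?_⟩
    have := sub_mem (Ideal.mul_mem_left _ (MvPowerSeries.X 2) hW) hUV
    convert this using 1; ring
  have m3 : (MvPowerSeries.X 3 : MvPowerSeries (Fin 4) K) ∈ (JJ K).radical := by
    refine ⟨2, ?_⟩
    have := sub_mem (Ideal.mul_mem_left _ (MvPowerSeries.X 3) hW) hUV
    convert this using 1; ring
  apply mem_of_coeff _ [Finsupp.single 1 1, Finsupp.single 2 1, Finsupp.single 3 1]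
  · intro m hm
    simp only [List.mem_cons, List.not_mem_nil, or_false] at hm
    rcases hm with rfl | rfl | rfl
    · exact m1
    · exact m2
    · exact m3
  · intro n hn
    apply h
    intro i hi
    by_contra hni
    have : Finsupp.single i 1 ≤ n := by simpa using Nat.one_le_iff_ne_zero.2 hni
    fin_cases i
    · exact hi rfl
    · exact hn _ (by simp) this
    · exact hn _ (by simp) this
    · exact hn _ (by simp) this

lemma krull_eq_one (y w : psHypersurface K)
    (hy : y = Ideal.Quotient.mk _ (MvPowerSeries.X 1))
    (hw : w = Ideal.Quotient.mk _ (MvPowerSeries.X 2) + Ideal.Quotient.mk _ (MvPowerSeries.X 3)) :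
    ringKrullDim (psHypersurface K ⧸ Ideal.span {y, w}) = 1 := by
  obtain ⟨φ, hφs, hφ, hφk⟩ := exists_phi K
  have h1 := hφ 1 (by decide)
  have h2 := hφ 2 (by decide)
  have h3 := hφ 3 (by decide)
  rw [dim_gen _ y w (MvPowerSeries.X 1) (MvPowerSeries.X 2 + MvPowerSeries.X 3) hy
    (by rw [hw, map_add]) φ hφs (by rw [map_sub, map_mul, map_mul, h1, h2]; ring) h1
    (by rw [map_add, h2, h3, add_zero]) ?_]
  · exact IsDiscreteValuationRing.ringKrullDim_eq_one (PowerSeries K)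
  · intro f hf
    obtain ⟨n, hn⟩ := mem_radical_JJ f (hφk f hf)
    refine ⟨n, ?_⟩
    rw [hy, hw]
    exact (mk_mem_iff _).2 hn

end final

/-- For `R = K[[X,Y,U,V]]/(XY-UV)`, `Ā = R/(y, u+v)` and `N = coker(ζ*)`:
`Ann_Ā N = 0` (i.e. `Ann_R N = (y, u+v)`), `dim_R N = 1`, `depth_R N = 0`
and `proj dim_R N = 3`. -/
theorem Nmod_ann_dim_depth_projDim (K : Type) [Field K]
    (x y u v : psHypersurface K)
    (hx : x = Ideal.Quotient.mk _ (MvPowerSeries.X 0))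
    (hy : y = Ideal.Quotient.mk _ (MvPowerSeries.X 1))
    (hu : u = Ideal.Quotient.mk _ (MvPowerSeries.X 2))
    (hv : v = Ideal.Quotient.mk _ (MvPowerSeries.X 3))
    (xb ub : Abar K y (u + v))
    (hxb : xb = Ideal.Quotient.mk _ x) (hub : ub = Ideal.Quotient.mk _ u) :
    Module.annihilator (psHypersurface K) (Nmod K y (u + v) xb ub)
        = Ideal.span {y, u + v} ∧
      ringKrullDim (psHypersurface K ⧸
        Module.annihilator (psHypersurface K) (Nmod K y (u + v) xb ub)) = 1 ∧
      HasDepth (psHypersurface K) (psHypersurface K ⧸ Ideal.span {x, y, u, v})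
        (Nmod K y (u + v) xb ub) 0 ∧
      HasProjDim (psHypersurface K) (psHypersurface K ⧸ Ideal.span {x, y, u, v})
        (Nmod K y (u + v) xb ub) 3 := by
  subst hxb hub
  have h1 : ∀ a, y * a = 0 → a = 0 := by
    intro a ha
    obtain ⟨a, rfl⟩ := Ideal.Quotient.mk_surjective a
    rw [hy, ← map_mul, mk_eq_zero_iff] at ha
    obtain ⟨g, hg⟩ := ha
    rw [mk_eq_zero_iff]
    exact fact_one _ _ hg
  have h2 : ∀ a b, y * a + (u + v) * b = 0 → ∃ q, b = y * q := by
    intro a b h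
    obtain ⟨a, rfl⟩ := Ideal.Quotient.mk_surjective a
    obtain ⟨b, rfl⟩ := Ideal.Quotient.mk_surjective b
    rw [hy, hu, hv, ← map_add, ← map_mul, ← map_mul, ← map_add, mk_eq_zero_iff] at h
    obtain ⟨g, hg⟩ := h
    obtain ⟨p, q, rfl⟩ := fact_two _ _ _ hg
    refine ⟨Ideal.Quotient.mk _ (p + MvPowerSeries.X 0 * q), ?_⟩
    rw [hy, ← map_mul, ← sub_eq_zero, ← map_sub, mk_eq_zero_iff]
    exact ⟨-q, by ring⟩
  have hmem : ∀ f : MvPowerSeries (Fin 4) K,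
      (Ideal.Quotient.mk _ f : psHypersurface K) ∈ Ideal.span {y, u + v} ↔ f ∈ JJ K := by
    intro f
    rw [hy, hu, hv]
    exact mk_mem_iff f
  have h3 : ∀ c, x * c ∈ Ideal.span {y, u + v} → c ∈ Ideal.span {y, u + v} := by
    intro c hc
    obtain ⟨c, rfl⟩ := Ideal.Quotient.mk_surjective c
    rw [hx, ← map_mul, hmem] at hc
    rw [hmem]
    exact fact_three c hc
  have h6 : ∀ a, u - a * x ∉ Ideal.span {y, u + v} := by
    intro a ha
    obtain ⟨a, rfl⟩ := Ideal.Quotient.mk_surjective a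
    have e : u - Ideal.Quotient.mk _ a * x =
        Ideal.Quotient.mk _ (MvPowerSeries.X 2 - a * MvPowerSeries.X 0) := by
      rw [hx, hu, map_sub, map_mul]
    rw [e, hmem] at ha
    exact fact_six a ha
  have huu : u * u ∈ Ideal.span {y, u + v} := by
    have hxy : x * y = u * v := by
      rw [hx, hy, hu, hv, ← map_mul, ← map_mul, ← sub_eq_zero, ← map_sub, mk_eq_zero_iff]
      exact ⟨1, by ring⟩
    rw [Ideal.mem_span_pair]
    exact ⟨-x, u, by linear_combination - hxy⟩
  have h4 : (1 : psHypersurface K) ∉ Ideal.span {x, y, u, v} := by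
    intro h
    let θ : psHypersurface K →+* K := Ideal.Quotient.lift _ MvPowerSeries.constantCoeff (by
      intro a ha
      rw [Ideal.mem_span_singleton'] at ha
      obtain ⟨g, rfl⟩ := ha
      simp)
    have hle : Ideal.span {x, y, u, v} ≤ RingHom.ker θ := by
      rw [Ideal.span_le]
      rintro z (rfl | rfl | rfl | rfl)
      · rw [hx]; exact MvPowerSeries.constantCoeff_X 0
      · rw [hy]; exact MvPowerSeries.constantCoeff_X 1
      · rw [hu]; exact MvPowerSeries.constantCoeff_X 2
      · rw [hv]; exact MvPowerSeries.constantCoeff_X 3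
    have := hle h
    rw [RingHom.mem_ker, map_one] at this
    exact one_ne_zero this
  have hann : Module.annihilator (psHypersurface K) (Nmod K y (u + v)
      (Ideal.Quotient.mk _ x) (Ideal.Quotient.mk _ u)) = Ideal.span {y, u + v} :=
    NN_annihilator h3
  refine ⟨hann, ?_, NN_depth rfl huu h6, NN_projDim rfl h1 h2 h3 h4⟩
  rw [hann]
  exact krull_eq_one y (u + v) hy (by rw [hu, hv])
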